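/- Let d = p^n - 3 with p^n > 3, and for b ∈ F = GF(p^n) let N(b) be the number of x ∈ F with (x+1)^d - x^d = b. Let ω₃ be the number of b ∈ F with N(b) = 3. Then 2·ω₃ = η(7)²·η(3)²·( (1 + η(2))·(1 - η(-7)) + (1 + η(-2))·(1 + η(-3)) ). -/

import Mathlib

open Finset

section InverseSquareDifference

variable {F : Type*} [Field F]

theorem FiniteField.pow_card_sub_three [Fintype F] (hq : 3 < Fintype.card F) (x : F) :
    x ^ (Fintype.card F - 3) = x⁻¹ ^ 2 := by
  rcases eq_or_ne x 0 with rfl | hx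
  · rw [zero_pow (by omega)]; simp
  · have h := FiniteField.pow_card_sub_one_eq_one x hx
    rw [show Fintype.card F - 1 = (Fintype.card F - 3) + 2 by omega, pow_add] at h
    rw [inv_pow]
    exact eq_inv_of_mul_eq_one_left h

/-- The difference in direction `1` of the power map with exponent `-2`, where `0⁻¹ = 0`. -/
def invSqDiff (x : F) : F := (x + 1)⁻¹ ^ 2 - x⁻¹ ^ 2

theorem invSqDiff_neg_one_sub (x : F) : invSqDiff (-1 - x) = -invSqDiff x := by
  unfold invSqDiff
  rw [show -1 - x + 1 = -x by ring, show -1 - x = -(x + 1) by ring, inv_neg, inv_neg]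
  ring

theorem invSqDiff_eq_iff {b : F} (hb1 : b ≠ 1) (hbn : b ≠ -1) {x : F} :
    invSqDiff x = b ↔ b * x ^ 2 * (x + 1) ^ 2 + 2 * x + 1 = 0 ∧ x ≠ 0 ∧ x + 1 ≠ 0 := by
  unfold invSqDiff
  rcases eq_or_ne x 0 with rfl | hx
  · simp [hb1.symm]
  rcases eq_or_ne (x + 1) 0 with h1 | h1
  · obtain rfl : x = -1 := by linear_combination h1
    simp [hbn.symm]
  simp only [hx, h1, ne_eq, not_false_eq_true, and_self, and_true]
  field_simp
  constructor <;> intro h <;> linear_combination -h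

theorem invSqDiff_eq_one_iff (h2 : (2 : F) ≠ 0) {x : F} :
    invSqDiff x = 1 ↔ x = 0 ∨ x ^ 4 + 2 * x ^ 3 + x ^ 2 + 2 * x + 1 = 0 := by
  unfold invSqDiff
  rcases eq_or_ne x 0 with rfl | hx
  · simp
  rcases eq_or_ne (x + 1) 0 with h1 | h1
  · obtain rfl : x = -1 := by linear_combination h1
    have h : (-1 : F) ≠ 1 := fun h => h2 (by linear_combination -h)
    norm_num [h]
  simp only [hx, false_or]
  field_simp
  constructor <;> intro h <;> linear_combination -h

variable [Fintype F] [DecidableEq F]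

theorem card_invSqDiff_neg (b : F) :
    #{x : F | invSqDiff x = -b} = #{x : F | invSqDiff x = b} := by
  refine card_bij' (fun x _ => -1 - x) (fun x _ => -1 - x) ?_ ?_ ?_ ?_ <;>
    simp +contextual [invSqDiff_neg_one_sub]

theorem card_invSqDiff_zero (h2 : (2 : F) ≠ 0) : #{x : F | invSqDiff x = 0} ≤ 1 := by
  refine card_le_one.2 fun x hx y hy => ?_
  simp only [mem_filter, mem_univ, true_and,
    invSqDiff_eq_iff (zero_ne_one) (neg_ne_zero.2 one_ne_zero).symm] at hx hy
  exact mul_left_cancel₀ h2 (by linear_combination hx.1 - hy.1)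

/-- The affine change of variable `y = 2 * x + 1` depresses the quartic of `invSqDiff x = b`. -/
theorem card_invSqDiff_eq_card_quartic (h2 : (2 : F) ≠ 0) {b : F} (hb1 : b ≠ 1) (hbn : b ≠ -1) :
    #{x : F | invSqDiff x = b} = #{y : F | b * (y ^ 2 - 1) ^ 2 + 16 * y = 0} := by
  refine card_bij' (fun x _ => 2 * x + 1) (fun y _ => (y - 1) / 2) ?_ ?_ ?_ ?_
  · intro x hx
    simp only [mem_filter, mem_univ, true_and, invSqDiff_eq_iff hb1 hbn] at hx ⊢
    linear_combination 16 * hx.1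
  · intro y hy
    simp only [mem_filter, mem_univ, true_and, invSqDiff_eq_iff hb1 hbn] at hy ⊢
    have h16 : (16 : F) ≠ 0 := by
      rw [show (16 : F) = 2 ^ 4 by norm_num]; exact pow_ne_zero _ h2
    have hx : 2 * ((y - 1) / 2) = y - 1 := by field_simp
    generalize (y - 1) / 2 = x at hx
    obtain rfl : y = 2 * x + 1 := by linear_combination -hx
    refine ⟨mul_left_cancel₀ h16 (by linear_combination hy), ?_, fun h => ?_⟩
    · rintro rfl; exact h16 (by linear_combination hy)
    · obtain rfl : x = -1 := by linear_combination h
      exact h16 (by linear_combination -hy)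
  · intro x _; field_simp; ring
  · intro y _; field_simp; ring

theorem card_quartic_eq_three_iff (h2 : (2 : F) ≠ 0) {b : F} (hb : b ≠ 0) :
    #{y : F | b * (y ^ 2 - 1) ^ 2 + 16 * y = 0} = 3 ↔ b ^ 2 = -27 ∧ IsSquare (-2 : F) := by
  have h16 : (16 : F) ≠ 0 := by
    rw [show (16 : F) = 2 ^ 4 by norm_num]; exact pow_ne_zero _ h2
  constructor
  · intro h
    obtain ⟨y₁, y₂, y₃, h12, h13, h23, hs⟩ := card_eq_three.1 h
    have hmem (y : F) : b * (y ^ 2 - 1) ^ 2 + 16 * y = 0 ↔ y = y₁ ∨ y = y₂ ∨ y = y₃ := by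
      simpa using congrArg (y ∈ ·) hs
    have e₁ := (hmem y₁).2 (by simp)
    have e₂ := (hmem y₂).2 (by simp)
    have e₃ := (hmem y₃).2 (by simp)
    have d12 : b * ((y₁ + y₂) * (y₁ ^ 2 + y₂ ^ 2 - 2)) + 16 = 0 :=
      mul_left_cancel₀ (sub_ne_zero.2 h12) (by linear_combination e₁ - e₂)
    have d13 : b * ((y₁ + y₃) * (y₁ ^ 2 + y₃ ^ 2 - 2)) + 16 = 0 :=
      mul_left_cancel₀ (sub_ne_zero.2 h13) (by linear_combination e₁ - e₃)
    have d : y₁ ^ 2 + y₂ ^ 2 + y₃ ^ 2 + y₁ * y₂ + y₁ * y₃ + y₂ * y₃ - 2 = 0 :=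
      mul_left_cancel₀ (mul_ne_zero hb (sub_ne_zero.2 h23)) (by linear_combination d12 - d13)
    have hf (t : F) : b * (t ^ 2 - 1) ^ 2 + 16 * t
        = b * ((t - y₁) * (t - y₂) * (t - y₃) * (t + y₁ + y₂ + y₃)) := by
      linear_combination e₁ + (t - y₁) * d12 + b * (t - y₁) * (t - y₂) * d
    -- the fourth root coincides with one of the other three
    have key (y u v : F) (hyu : y ≠ u) (huv : u ≠ v) (hs : u + v = -2 * y)
        (hf : ∀ t : F, b * (t ^ 2 - 1) ^ 2 + 16 * t
          = b * ((t - y) ^ 2 * (t - u) * (t - v))) : b ^ 2 = -27 ∧ IsSquare (-2 : F) := by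
      obtain rfl : v = -2 * y - u := by linear_combination hs
      have f0 := hf 0
      have f1 := hf 1
      have fm := hf (-1)
      have fy := hf y
      have hpq : u * (-2 * y - u) = 3 * y ^ 2 - 2 :=
        mul_left_cancel₀ (mul_ne_zero hb h2) (by linear_combination 2 * f0 - f1 - fm)
      have hy1 : y ^ 2 - 1 ≠ 0 := by
        intro h0
        have : y = 0 := mul_left_cancel₀ h16 (by linear_combination fy - b * (y ^ 2 - 1) * h0)
        subst this
        exact one_ne_zero (α := F) (by linear_combination -h0)
      have hy3 : 3 * y ^ 2 + 1 = 0 :=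
        mul_left_cancel₀ (mul_ne_zero hb hy1) (by linear_combination -f0 - b * y ^ 2 * hpq)
      have hy0 : y ≠ 0 := by
        rintro rfl; exact one_ne_zero (α := F) (by linear_combination hy3)
      have hb9 : b = -9 * y :=
        mul_left_cancel₀ h16 (by
          linear_combination 9 * fy - b * (3 * y ^ 2 - 7) * hy3)
      refine ⟨by rw [hb9]; linear_combination 27 * hy3, (u + y) / (2 * y), ?_⟩
      field_simp
      linear_combination hpq - 2 * hy3
    have h4 : b * ((-(y₁ + y₂ + y₃)) ^ 2 - 1) ^ 2 + 16 * (-(y₁ + y₂ + y₃)) = 0 := by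
      rw [hf]; ring
    rcases (hmem _).1 h4 with h4 | h4 | h4
    · refine key y₁ y₂ y₃ h12 h23 (by linear_combination -h4) fun t => ?_
      rw [hf, ← sub_eq_zero]
      linear_combination -b * ((t - y₁) * (t - y₂) * (t - y₃)) * h4
    · refine key y₂ y₁ y₃ h12.symm h13 (by linear_combination -h4) fun t => ?_
      rw [hf, ← sub_eq_zero]
      linear_combination -b * ((t - y₁) * (t - y₂) * (t - y₃)) * h4
    · refine key y₃ y₁ y₂ h13.symm h12 (by linear_combination -h4) fun t => ?_
      rw [hf, ← sub_eq_zero]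
      linear_combination -b * ((t - y₁) * (t - y₂) * (t - y₃)) * h4
  · rintro ⟨hb2, s, hs⟩
    have h3 : (3 : F) ≠ 0 := fun h3 =>
      pow_ne_zero 2 hb (by linear_combination hb2 - 9 * h3)
    have hs1 (h : s ^ 2 = 1) : False := h3 (by linear_combination -hs - h)
    have hs0 : s ≠ 0 := by rintro rfl; exact h2 (by linear_combination -hs)
    obtain ⟨y, rfl⟩ : ∃ y, b = -9 * y := ⟨-b / 9, by
      have : (9 : F) ≠ 0 := by
        rw [show (9 : F) = 3 ^ 2 by norm_num]; exact pow_ne_zero _ h3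
      field_simp⟩
    have hy0 : y ≠ 0 := by rintro rfl; simp at hb
    have hy3 : 3 * y ^ 2 = -1 :=
      mul_left_cancel₀ (pow_ne_zero 3 h3) (by linear_combination hb2)
    refine card_eq_three.2 ⟨y, -y + 2 * s * y, -y - 2 * s * y, ?_, ?_, ?_, ?_⟩
    · intro h
      have : s = 1 := mul_left_cancel₀ (mul_ne_zero h2 hy0) (by linear_combination -h)
      exact hs1 (by simp [this])
    · intro h
      have : s = -1 := mul_left_cancel₀ (mul_ne_zero h2 hy0) (by linear_combination h)
      exact hs1 (by simp [this])
    · intro h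
      exact mul_ne_zero (mul_ne_zero h2 h2) (mul_ne_zero hs0 hy0) (by linear_combination h)
    · ext t
      have hf : -9 * y * (t ^ 2 - 1) ^ 2 + 16 * t
          = -9 * y * ((t - y) ^ 2 * (t - (-y + 2 * s * y)) * (t - (-y - 2 * s * y))) := by
        linear_combination (18 * y * t ^ 2 - 9 * y * (1 - 3 * y ^ 2) + 16 * t * (1 - 3 * y ^ 2)) * hy3
          + 36 * y ^ 3 * (t - y) ^ 2 * hs
      simp only [mem_filter, mem_univ, true_and, mem_insert, mem_singleton, hf, mul_eq_zero, hb,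
        false_or, pow_eq_zero_iff, sub_eq_zero, ne_eq, OfNat.ofNat_ne_zero, not_false_eq_true,
        or_assoc]

theorem card_palindromic_quartic_eq_two_iff (h2 : (2 : F) ≠ 0) :
    #{x : F | x ^ 4 + 2 * x ^ 3 + x ^ 2 + 2 * x + 1 = 0} = 2 ↔
      IsSquare (2 : F) ∧ ¬IsSquare (-7 : F) := by
  -- with `z = x + x⁻¹` the equation reads `(z + 1) ^ 2 = 2`
  have hz {x : F} (hx : x ≠ 0) :
      x ^ 4 + 2 * x ^ 3 + x ^ 2 + 2 * x + 1 = 0 ↔ (x + x⁻¹ + 1) ^ 2 = 2 := by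
    field_simp
    constructor <;> intro h <;> linear_combination h
  have h0 {x : F} (hx : x ^ 4 + 2 * x ^ 3 + x ^ 2 + 2 * x + 1 = 0) : x ≠ 0 := by
    rintro rfl; simp at hx
  constructor
  · intro h
    obtain ⟨x, y, hxy, hs⟩ := card_eq_two.1 h
    have hmem (t : F) : t ^ 4 + 2 * t ^ 3 + t ^ 2 + 2 * t + 1 = 0 ↔ t = x ∨ t = y := by
      simpa using congrArg (t ∈ ·) hs
    obtain ⟨u, hu, hu1⟩ : ∃ u : F, u ^ 4 + 2 * u ^ 3 + u ^ 2 + 2 * u + 1 = 0 ∧ u ≠ 1 := by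
      by_cases hx1 : x = 1
      · exact ⟨y, (hmem y).2 (by simp), fun hy => hxy (hx1.trans hy.symm)⟩
      · exact ⟨x, (hmem x).2 (by simp), hx1⟩
    have hu0 := h0 hu
    have hur := (hz hu0).1 hu
    have hun : u ≠ -1 := by
      rintro rfl; exact one_ne_zero (α := F) (by linear_combination -hu)
    have hui : u ≠ u⁻¹ := by
      intro h
      have : (u - 1) * (u + 1) = 0 := by
        field_simp at h
        linear_combination h
      rcases mul_eq_zero.1 this with h | h
      · exact hu1 (by linear_combination h)
      · exact hun (by linear_combination h)
    have hui' : u⁻¹ ^ 4 + 2 * u⁻¹ ^ 3 + u⁻¹ ^ 2 + 2 * u⁻¹ + 1 = 0 := by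
      rw [hz (inv_ne_zero hu0), inv_inv, add_comm u⁻¹, hur]
    refine ⟨⟨u + u⁻¹ + 1, by rw [← hur, sq]⟩, ?_⟩
    rintro ⟨w, hw⟩
    have hd : u - u⁻¹ ≠ 0 := sub_ne_zero.2 hui
    set r := u + u⁻¹ + 1 with hr
    have hD : (u - u⁻¹) ^ 2 = -1 - 2 * r := by
      have : u * u⁻¹ = 1 := mul_inv_cancel₀ hu0
      linear_combination hur - 4 * this
    obtain ⟨w', hw'⟩ : ∃ w' : F, w' ^ 2 = -1 + 2 * r := by
      refine ⟨w / (u - u⁻¹), ?_⟩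
      rw [div_pow, div_eq_iff (pow_ne_zero 2 hd), hD]
      linear_combination -hw + 4 * hur
    obtain ⟨v, hv⟩ : ∃ v : F, v ^ 2 + (1 + r) * v + 1 = 0 := by
      refine ⟨(-1 - r + w') / 2, ?_⟩
      field_simp
      linear_combination hw' - hur
    have hvr : v ^ 4 + 2 * v ^ 3 + v ^ 2 + 2 * v + 1 = 0 := by
      linear_combination (v ^ 2 + (1 - r) * v + 1) * hv + v ^ 2 * hur
    have hv0 := h0 hvr
    have hzv : v + v⁻¹ + 1 = -r := by
      field_simp
      linear_combination hv
    have hr0 : r ≠ 0 := by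
      intro h
      rw [h] at hur
      exact h2 (by linear_combination -hur)
    have hvu : v ≠ u := by
      rintro rfl
      exact mul_ne_zero h2 hr0 (by linear_combination hr + hzv)
    have hvi : v ≠ u⁻¹ := by
      rintro rfl
      rw [inv_inv] at hzv
      exact mul_ne_zero h2 hr0 (by linear_combination hr + hzv)
    have e1 := (hmem u).1 hu
    have e2 := (hmem u⁻¹).1 hui'
    have e3 := (hmem v).1 hvr
    rcases e1 with e1 | e1 <;> rcases e2 with e2 | e2 <;> rcases e3 with e3 | e3 <;>
      first
        | exact hui (e1.trans e2.symm)
        | exact hvu (e3.trans e1.symm)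
        | exact hvi (e3.trans e2.symm)
  · rintro ⟨⟨r, hr⟩, h7⟩
    have key (r w : F) (hr : 2 = r * r) (hw : -1 - 2 * r = w * w) :
        #{x : F | x ^ 4 + 2 * x ^ 3 + x ^ 2 + 2 * x + 1 = 0} = 2 := by
      have hw0 : w ≠ 0 := by
        rintro rfl
        exact h7 ⟨0, by linear_combination (2 * r - 1) * hw - 4 * hr⟩
      refine card_eq_two.2 ⟨(-1 + r + w) / 2, (-1 + r - w) / 2, ?_, ?_⟩
      · intro h
        field_simp at h
        exact mul_ne_zero h2 hw0 (by linear_combination h)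
      · ext x
        simp only [mem_filter, mem_univ, true_and, mem_insert, mem_singleton]
        have hf : x ^ 4 + 2 * x ^ 3 + x ^ 2 + 2 * x + 1
            = (x ^ 2 + (1 + r) * x + 1) * ((x - (-1 + r + w) / 2) * (x - (-1 + r - w) / 2)) := by
          field_simp
          linear_combination (-(x ^ 2 + (1 + r) * x + 1)) * hw
            + (x ^ 2 + (1 + r) * x + 1 - 4 * x ^ 2) * hr
        have hne : x ^ 2 + (1 + r) * x + 1 ≠ 0 := by
          intro h
          have hsq : -1 + 2 * r = (2 * x + 1 + r) ^ 2 := by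
            linear_combination -4 * h + hr
          exact h7 ⟨w * (2 * x + 1 + r), by
            linear_combination (-1 + 2 * r) * hw + w ^ 2 * hsq - 4 * hr⟩
        simp [hf, hne, sub_eq_zero]
    by_cases h1 : IsSquare (-1 - 2 * r)
    · obtain ⟨w, hw⟩ := h1
      exact key r w hr hw
    · have h2' : IsSquare (-1 + 2 * r) := by
        by_contra h2'
        rw [← quadraticChar_neg_one_iff_not_isSquare] at h1 h2' h7
        have hm := map_mul (quadraticChar F) (-1 - 2 * r) (-1 + 2 * r)
        rw [show (-1 - 2 * r) * (-1 + 2 * r) = -7 by linear_combination 4 * hr, h1, h2', h7] at hm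
        norm_num at hm
      obtain ⟨w, hw⟩ := h2'
      exact key (-r) w (by linear_combination hr) (by linear_combination hw)

theorem card_invSqDiff_one_eq_three_iff (h2 : (2 : F) ≠ 0) :
    #{x : F | invSqDiff x = 1} = 3 ↔ IsSquare (2 : F) ∧ ¬IsSquare (-7 : F) := by
  have : ({x : F | invSqDiff x = 1} : Finset F)
      = insert 0 ({x : F | x ^ 4 + 2 * x ^ 3 + x ^ 2 + 2 * x + 1 = 0} : Finset F) := by
    ext x
    simp [invSqDiff_eq_one_iff h2]
  rw [← card_palindromic_quartic_eq_two_iff h2, this, card_insert_of_notMem (by simp)]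
  omega

theorem card_invSqDiff_eq_three_iff (h2 : (2 : F) ≠ 0) (b : F) :
    #{x : F | invSqDiff x = b} = 3 ↔
      ((b = 1 ∨ b = -1) ∧ IsSquare (2 : F) ∧ ¬IsSquare (-7 : F)) ∨
      (b ≠ 0 ∧ b ≠ 1 ∧ b ≠ -1 ∧ b ^ 2 = -27 ∧ IsSquare (-2 : F)) := by
  by_cases hb1 : b = 1
  · subst hb1
    simp [card_invSqDiff_one_eq_three_iff h2]
  by_cases hbn : b = -1
  · subst hbn
    simp [card_invSqDiff_neg, card_invSqDiff_one_eq_three_iff h2]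
  by_cases hb : b = 0
  · subst hb
    have := card_invSqDiff_zero h2
    simp only [zero_ne_one, hbn, ne_eq, not_true_eq_false, false_and, or_self, iff_false]
    omega
  simp [card_invSqDiff_eq_card_quartic h2 hb1 hbn, card_quartic_eq_three_iff h2 hb, hb1, hbn, hb]

end InverseSquareDifference

/-- With `d = p^n - 3`, `p^n > 3`, `N(b) = #{x ∈ F : (x+1)^d - x^d = b}` and
`ω₃ = #{b ∈ F : N(b) = 3}`:
`2ω₃ = η(7)²η(3)²((1 + η(2))(1 - η(-7)) + (1 + η(-2))(1 + η(-3)))`. -/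
theorem stmt_14 (p n : ℕ) (hp : p.Prime) (hp2 : p ≠ 2) (hn : 0 < n)
    (F : Type*) [Field F] [Fintype F] [DecidableEq F]
    (hF : Fintype.card F = p ^ n)
    (hq : 3 < p ^ n)
    (η : F → ℤ)
    (hη0 : η 0 = 0)
    (hη1 : ∀ x : F, x ≠ 0 → IsSquare x → η x = 1)
    (hη2 : ∀ x : F, ¬ IsSquare x → η x = -1) :
    2 * ((Finset.univ.filter (fun b : F =>
        (Finset.univ.filter
          (fun x : F => (x + 1) ^ (p ^ n - 3) - x ^ (p ^ n - 3) = b)).card = 3)).card : ℤ) =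
      η 7 ^ 2 * η 3 ^ 2 *
        ((1 + η 2) * (1 - η (-7)) + (1 + η (-2)) * (1 + η (-3))) := by
  have hpF : (p : F) = 0 := by
    have h := Nat.cast_card_eq_zero F
    rw [hF, Nat.cast_pow] at h
    exact eq_zero_of_pow_eq_zero h
  have h2 : (2 : F) ≠ 0 := by
    intro h2
    obtain ⟨k, hk⟩ := hp.odd_of_ne_two hp2
    rw [hk] at hpF
    push_cast at hpF
    exact one_ne_zero (α := F) (by linear_combination hpF - k * h2)
  have hpow (x : F) : x ^ (p ^ n - 3) = x⁻¹ ^ 2 := by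
    rw [← hF] at hq ⊢
    exact FiniteField.pow_card_sub_three hq x
  have hN (b : F) : #{x : F | (x + 1) ^ (p ^ n - 3) - x ^ (p ^ n - 3) = b} = 3 ↔
      ((b = 1 ∨ b = -1) ∧ IsSquare (2 : F) ∧ ¬IsSquare (-7 : F)) ∨
      (b ≠ 0 ∧ b ≠ 1 ∧ b ≠ -1 ∧ b ^ 2 = -27 ∧ IsSquare (-2 : F)) := by
    rw [← card_invSqDiff_eq_three_iff h2 b]
    refine iff_of_eq (congrArg (#· = 3) (filter_congr fun x _ => ?_))
    rw [hpow, hpow, invSqDiff]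
  rw [filter_congr fun b _ => hN b]
  clear hN hpow
  have hn1 : (-1 : F) ≠ 1 := fun h => h2 (by linear_combination -h)
  by_cases h3 : (3 : F) = 0
  · have h7 : IsSquare (-7 : F) ↔ IsSquare (2 : F) := by
      rw [show (-7 : F) = 2 by linear_combination -3 * h3]
    have h27 : (-27 : F) = 0 := by linear_combination -9 * h3
    rw [h3, hη0, filter_false_of_mem]
    · simp
    · intro b _
      rw [h7, h27]
      simp +contextual
  by_cases h7 : (7 : F) = 0
  · have h7' : (-7 : F) = 0 := by simp [h7]
    have h27 : (-27 : F) = 1 := by linear_combination -4 * h7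
    rw [h7', h7, hη0, filter_false_of_mem]
    · simp
    · intro b _
      rw [h27, sq_eq_one_iff]
      simp only [IsSquare.zero, not_true_eq_false, and_false, false_or]
      tauto
  have hsq {x : F} (hx : x ≠ 0) : η x = if IsSquare x then 1 else -1 := by
    split_ifs with h
    exacts [hη1 x hx h, hη2 x h]
  have hsq2 {x : F} (hx : x ≠ 0) : η x ^ 2 = 1 := by
    rw [hsq hx]; split_ifs <;> simp
  rw [hsq2 h7, hsq2 h3, hsq h2, hsq (neg_ne_zero.2 h2), hsq (neg_ne_zero.2 h3),
    hsq (neg_ne_zero.2 h7)]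
  have hA : #{b : F | (b = 1 ∨ b = -1) ∧ IsSquare (2 : F) ∧ ¬IsSquare (-7 : F)}
      = if IsSquare (2 : F) ∧ ¬IsSquare (-7 : F) then 2 else 0 := by
    split_ifs with h
    · refine card_eq_two.2 ⟨1, -1, hn1.symm, ?_⟩
      ext b
      simp [h]
    · simp [h]
  have hB : #{b : F | b ≠ 0 ∧ b ≠ 1 ∧ b ≠ -1 ∧ b ^ 2 = -27 ∧ IsSquare (-2 : F)}
      = if IsSquare (-3 : F) ∧ IsSquare (-2 : F) then 2 else 0 := by
    split_ifs with h
    · obtain ⟨⟨c, hc⟩, h⟩ := h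
      have hc0 : c ≠ 0 := by
        rintro rfl
        exact h3 (by linear_combination -hc)
      refine card_eq_two.2 ⟨3 * c, -(3 * c), fun h => ?_, ?_⟩
      · exact mul_ne_zero h2 (mul_ne_zero h3 hc0) (by linear_combination h)
      · ext b
        have h28 : (28 : F) ≠ 0 := by
          rw [show (28 : F) = 2 * 2 * 7 by norm_num]
          exact mul_ne_zero (mul_ne_zero h2 h2) h7
        have h27 : (-27 : F) = (3 * c) ^ 2 := by linear_combination 9 * hc
        simp only [mem_filter, mem_univ, true_and, mem_insert, mem_singleton, h, and_true, h27,
          sq_eq_sq_iff_eq_or_eq_neg]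
        refine ⟨fun h => h.2.2.2, fun hb => ?_⟩
        have hb2 := sq_eq_sq_iff_eq_or_eq_neg.2 hb
        rw [← h27] at hb2
        refine ⟨?_, ?_, ?_, hb⟩
        · rintro rfl
          exact pow_ne_zero 3 h3 (by linear_combination hb2)
        · rintro rfl
          exact h28 (by linear_combination hb2)
        · rintro rfl
          exact h28 (by linear_combination hb2)
    · rw [filter_false_of_mem, card_empty]
      rintro b - ⟨-, -, -, hb, hs⟩
      exact h ⟨⟨b / 3, by field_simp; linear_combination -hb⟩, hs⟩
  rw [filter_or, card_union_of_disjoint, hA, hB]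
  · by_cases s2 : IsSquare (2 : F) <;> by_cases s7 : IsSquare (-7 : F) <;>
      by_cases sn2 : IsSquare (-2 : F) <;> by_cases s3 : IsSquare (-3 : F) <;>
      simp [s2, s7, sn2, s3]
  · rw [disjoint_filter]
    tauto
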